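/- Let n = n₁ + n₂ − 1, let x ∈ ℂⁿ be such that L = ℋ(x) has rank r and is μ-incoherent, with singular values σ₁ ≥ ⋯ ≥ σ_r > 0 and condition number κ = σ₁/σ_r, and let s ∈ ℂⁿ be α-sparse with α ≤ c/(μ c_s r κ)² for a sufficiently small absolute constant c > 0. Set τ = 4αμ c_s r κ and z = x + s. Suppose β_init satisfies μ c_s r σ₁/(n σ₁(ℋ(z))) ≤ β_init ≤ 3μ c_s r σ₁/(n σ₁(ℋ(z))). Define ζ₀ = β_init σ₁(ℋ(z)), s₀ = T_{ζ₀}(z), L₀ = D_r(ℋ(z − s₀)) a best rank-r approximation of ℋ(z − s₀), and x₀ = ℋ†(L₀). Then ‖L − L₀‖₂ ≤ 2τσ_r, ‖x − x₀‖_∞ ≤ ((τ − 2τ²)/(8ακn))σ_r, and L₀ is 4μκ²-incoherent. -/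

import Mathlib

open Matrix
open scoped BigOperators

noncomputable section

namespace ASAP

/-- The Hankel operator `ℋ : ℂⁿ → ℂ^{n₁×n₂}`, `[ℋ(x)]_{i,j} = x_{i+j}`. -/
def hankel {n₁ n₂ n : ℕ} (hn : n + 1 = n₁ + n₂) (x : Fin n → ℂ) :
    Matrix (Fin n₁) (Fin n₂) ℂ :=
  Matrix.of fun i j => x ⟨i.1 + j.1, by have hi := i.2; have hj := j.2; omega⟩

open Classical in
/-- The left inverse `ℋ†` of the Hankel operator: averages over antidiagonals. -/
def hankelDagger {n₁ n₂ n : ℕ} (_hn : n + 1 = n₁ + n₂)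
    (M : Matrix (Fin n₁) (Fin n₂) ℂ) : Fin n → ℂ := fun t =>
  (((Finset.univ.filter fun p : Fin n₁ × Fin n₂ => p.1.1 + p.2.1 = t.1).card : ℂ))⁻¹ *
    ∑ p ∈ Finset.univ.filter fun p : Fin n₁ × Fin n₂ => p.1.1 + p.2.1 = t.1, M p.1 p.2

/-- Spectral norm (largest singular value) of a matrix. -/
def specNorm {m n : Type*} [Fintype m] [Fintype n] [DecidableEq n]
    (M : Matrix m n ℂ) : ℝ :=
  ‖LinearMap.toContinuousLinearMap (Matrix.toEuclideanLin M)‖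

/-- Frobenius norm of a matrix. -/
def frobNorm {m n : Type*} [Fintype m] [Fintype n] (M : Matrix m n ℂ) : ℝ :=
  Real.sqrt (∑ i, ∑ j, ‖M i j‖ ^ 2)

/-- `‖·‖_{2,∞}`: maximum ℓ₂ norm of the rows of a matrix. -/
def rowNorm {m n : Type*} [Fintype m] [Fintype n] (M : Matrix m n ℂ) : ℝ :=
  ⨆ i, Real.sqrt (∑ j, ‖M i j‖ ^ 2)

/-- Entrywise max norm of a matrix. -/
def maxNorm {m n : Type*} [Fintype m] [Fintype n] (M : Matrix m n ℂ) : ℝ :=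
  ⨆ i, ⨆ j, ‖M i j‖

/-- ℓ∞ norm of a vector. -/
def vecMaxNorm {n : Type*} [Fintype n] (v : n → ℂ) : ℝ :=
  ⨆ t, ‖v t‖

/-- ℓ₂ norm of a vector. -/
def vecTwoNorm {n : Type*} [Fintype n] (v : n → ℂ) : ℝ :=
  Real.sqrt (∑ t, ‖v t‖ ^ 2)

/-- The augmented Hermitian matrix `[[0, M], [Mᴴ, 0]]`. -/
def aug {m n : Type*} (M : Matrix m n ℂ) : Matrix (m ⊕ n) (m ⊕ n) ℂ :=
  Matrix.fromBlocks 0 M Mᴴ 0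

open Classical in
/-- Support (set of indices of nonzero entries) of a vector. -/
def supp {n : Type*} [Fintype n] (v : n → ℂ) : Finset n :=
  Finset.univ.filter fun t => v t ≠ 0

/-- `α`-sparsity: at most `α·n` nonzero entries. -/
def IsSparse {n : ℕ} (α : ℝ) (s : Fin n → ℂ) : Prop :=
  ((supp s).card : ℝ) ≤ α * n

/-- The hard thresholding operator `T_ζ`. -/
def hardThreshold {n : ℕ} (ζ : ℝ) (v : Fin n → ℂ) : Fin n → ℂ := fun t =>
  if ζ < ‖v t‖ then v t else 0

/-- `c_s = max {n/n₁, n/n₂}`. -/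
def csConst (n₁ n₂ n : ℕ) : ℝ :=
  max ((n : ℝ) / n₁) ((n : ℝ) / n₂)

/-- `(U, σ, V)` is a (compact, rank-`r`, positive and ordered) singular value
decomposition of `L`, i.e. `L = U Σ V*` with orthonormal columns. -/
def IsSVD {m n : Type*} [Fintype m] [Fintype n] {r : ℕ}
    (L : Matrix m n ℂ) (U : Matrix m (Fin r) ℂ) (σ : Fin r → ℝ)
    (V : Matrix n (Fin r) ℂ) : Prop :=
  Uᴴ * U = 1 ∧ Vᴴ * V = 1 ∧ (∀ i, 0 < σ i) ∧ (∀ i j : Fin r, i ≤ j → σ j ≤ σ i) ∧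
    L = U * Matrix.diagonal (fun i => (σ i : ℂ)) * Vᴴ

/-- `μ`-incoherence of a rank-`r` matrix (with respect to `c_s` and `n`). -/
def IsIncoherent {m n' : Type*} [Fintype m] [Fintype n'] (r n : ℕ) (μ cs : ℝ)
    (L : Matrix m n' ℂ) : Prop :=
  ∃ (U : Matrix m (Fin r) ℂ) (σ : Fin r → ℝ) (V : Matrix n' (Fin r) ℂ),
    IsSVD L U σ V ∧ rowNorm U ≤ Real.sqrt (μ * cs * r / n) ∧
      rowNorm V ≤ Real.sqrt (μ * cs * r / n)

/-- Orthogonal projection onto the tangent space determined by `U` and `V`: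
`P_T M = UU*M + MVV* − UU*MVV*`. -/
def tangentProj {m n : Type*} [Fintype m] [Fintype n] {r : ℕ}
    (U : Matrix m (Fin r) ℂ) (V : Matrix n (Fin r) ℂ)
    (M : Matrix m n ℂ) : Matrix m n ℂ :=
  U * Uᴴ * M + M * (V * Vᴴ) - U * Uᴴ * M * (V * Vᴴ)

/-- `L` is a best rank-`r` approximation of `A` with respect to the norm `nrm`. -/
def IsBestApproxWrt {m n : Type*} [Fintype m] [Fintype n] (r : ℕ)
    (nrm : Matrix m n ℂ → ℝ) (A L : Matrix m n ℂ) : Prop :=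
  L.rank ≤ r ∧ ∀ B : Matrix m n ℂ, B.rank ≤ r → nrm (A - L) ≤ nrm (A - B)

/-- Best rank-`r` approximation in Frobenius norm (truncated SVD, `D_r`). -/
def IsBestRankApprox {m n : Type*} [Fintype m] [Fintype n] (r : ℕ)
    (A L : Matrix m n ℂ) : Prop :=
  IsBestApproxWrt r frobNorm A L

/-- Horizontal concatenation of two matrices. -/
def hcat {m a b : Type*} (A : Matrix m a ℂ) (B : Matrix m b ℂ) :
    Matrix m (a ⊕ b) ℂ :=
  Matrix.of fun i => Sum.elim (A i) (B i)


set_option linter.unusedSectionVars false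

/-- Euclidean norm of a plain vector. -/
def vn {ι : Type*} [Fintype ι] (v : ι → ℂ) : ℝ := ‖(WithLp.toLp 2 v : EuclideanSpace ℂ ι)‖

lemma vn_eq {ι : Type*} [Fintype ι] (v : ι → ℂ) : vn v = Real.sqrt (∑ i, ‖v i‖ ^ 2) := by
  simp [vn, EuclideanSpace.norm_eq]

lemma vn_sq {ι : Type*} [Fintype ι] (v : ι → ℂ) : vn v ^ 2 = ∑ i, ‖v i‖ ^ 2 := by
  rw [vn_eq, Real.sq_sqrt (Finset.sum_nonneg fun _ _ => by positivity)]

lemma vn_nonneg {ι : Type*} [Fintype ι] (v : ι → ℂ) : 0 ≤ vn v := norm_nonneg _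

lemma vn_add {ι : Type*} [Fintype ι] (v w : ι → ℂ) : vn (v + w) ≤ vn v + vn w := by
  simpa [vn] using norm_add_le (WithLp.toLp 2 v : EuclideanSpace ℂ ι) (WithLp.toLp 2 w)

lemma vn_sub {ι : Type*} [Fintype ι] (v w : ι → ℂ) : vn (v - w) ≤ vn v + vn w := by
  simpa [vn] using norm_sub_le (WithLp.toLp 2 v : EuclideanSpace ℂ ι) (WithLp.toLp 2 w)

lemma vn_smul {ι : Type*} [Fintype ι] (c : ℂ) (v : ι → ℂ) : vn (c • v) = ‖c‖ * vn v := by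
  simpa [vn] using norm_smul c (WithLp.toLp 2 v : EuclideanSpace ℂ ι)

lemma vn_star {ι : Type*} [Fintype ι] (v : ι → ℂ) : vn (star v) = vn v := by
  simp [vn_eq]

lemma vn_pos {ι : Type*} [Fintype ι] {v : ι → ℂ} (h : v ≠ 0) : 0 < vn v := by
  rw [vn, norm_pos_iff]
  intro h2
  apply h
  simpa using h2

lemma vn_dot {ι : Type*} [Fintype ι] (v : ι → ℂ) : star v ⬝ᵥ v = ((vn v ^ 2 : ℝ) : ℂ) := by
  rw [vn_sq, dotProduct]
  push_cast
  refine Finset.sum_congr rfl fun i _ => ?_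
  simp [Complex.conj_mul']

lemma vn_apply {ι : Type*} [Fintype ι] (v : ι → ℂ) (i : ι) : ‖v i‖ ≤ vn v := by
  simpa [vn] using EuclideanSpace.norm_eq (WithLp.toLp 2 v : EuclideanSpace ℂ ι) ▸
    Real.le_sqrt_of_sq_le (Finset.single_le_sum (f := fun i => ‖v i‖ ^ 2)
      (fun _ _ => by positivity) (Finset.mem_univ i))

lemma dot_le {ι : Type*} [Fintype ι] (v w : ι → ℂ) : ‖v ⬝ᵥ w‖ ≤ vn v * vn w := by
  have h := norm_inner_le_norm (𝕜 := ℂ) (WithLp.toLp 2 (star v) : EuclideanSpace ℂ ι)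
    (WithLp.toLp 2 w)
  rw [EuclideanSpace.inner_eq_star_dotProduct] at h
  simp only [star_star] at h
  rw [dotProduct_comm] at h
  change _ ≤ vn (star v) * vn w at h
  rwa [vn_star] at h

open scoped Matrix.Norms.L2Operator in
lemma specNorm_eq {m n : Type*} [Fintype m] [Fintype n] [DecidableEq n]
    (M : Matrix m n ℂ) : specNorm M = ‖M‖ := rfl

section
variable {m n l : Type*} [Fintype m] [Fintype n] [Fintype l] [DecidableEq m] [DecidableEq n]
  [DecidableEq l]

lemma sn_nonneg (M : Matrix m n ℂ) : 0 ≤ specNorm M := norm_nonneg _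

open scoped Matrix.Norms.L2Operator in
lemma sn_mul (M : Matrix m n ℂ) (M' : Matrix n l ℂ) :
    specNorm (M * M') ≤ specNorm M * specNorm M' := l2_opNorm_mul M M'

open scoped Matrix.Norms.L2Operator in
lemma sn_conj (M : Matrix m n ℂ) : specNorm Mᴴ = specNorm M := l2_opNorm_conjTranspose M

open scoped Matrix.Norms.L2Operator in
lemma sn_sub (M M' : Matrix m n ℂ) : specNorm (M - M') ≤ specNorm M + specNorm M' :=
  norm_sub_le M M'

open scoped Matrix.Norms.L2Operator in
lemma sn_mulVec (M : Matrix m n ℂ) (v : n → ℂ) : vn (M *ᵥ v) ≤ specNorm M * vn v :=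
  l2_opNorm_mulVec M (WithLp.toLp 2 v)

lemma sn_le (M : Matrix m n ℂ) {K : ℝ} (hK : 0 ≤ K) (h : ∀ v, vn (M *ᵥ v) ≤ K * vn v) :
    specNorm M ≤ K :=
  ContinuousLinearMap.opNorm_le_bound _ hK fun x => h x.ofLp

lemma mulVec_iso {Y : Matrix m n ℂ} (h : Yᴴ * Y = 1) (v : n → ℂ) : vn (Y *ᵥ v) = vn v := by
  have : ((vn (Y *ᵥ v) ^ 2 : ℝ) : ℂ) = ((vn v ^ 2 : ℝ) : ℂ) := by
    rw [← vn_dot, ← vn_dot, star_mulVec, dotProduct_mulVec, vecMul_vecMul, h, vecMul_one]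
  have h2 : vn (Y *ᵥ v) ^ 2 = vn v ^ 2 := by exact_mod_cast this
  exact (sq_eq_sq₀ (vn_nonneg _) (vn_nonneg _)).1 h2

lemma sn_iso {Y : Matrix m n ℂ} (h : Yᴴ * Y = 1) : specNorm Y ≤ 1 :=
  sn_le _ zero_le_one fun v => by rw [mulVec_iso h, one_mul]

lemma sn_iso_conj {Y : Matrix m n ℂ} (h : Yᴴ * Y = 1) : specNorm Yᴴ ≤ 1 := by
  rw [sn_conj]; exact sn_iso h

lemma row_mul (M : Matrix m n ℂ) (M' : Matrix n l ℂ) (i : m) :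
    vn ((M * M') i) ≤ vn (M i) * specNorm M' := by
  have h := sn_mulVec M'ᴴ (star (M i))
  rw [sn_conj, vn_star, mulVec_conjTranspose, star_star, vn_star] at h
  rw [mul_comm]
  exact h

lemma entry_mul (M : Matrix m n ℂ) (M' : Matrix l n ℂ) (i : m) (j : l) :
    ‖(M * M'ᴴ) i j‖ ≤ vn (M i) * vn (M' j) := by
  have h := dot_le (M i) (star (M' j))
  rw [vn_star] at h
  exact h

lemma row_sparse (E : Matrix m n ℂ) (Y : Matrix n l ℂ) (i : m) {K v : ℝ} (hv0 : 0 ≤ v)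
    (hE : ∑ j, ‖E i j‖ ≤ K) (hv : ∀ j, vn (Y j) ≤ v) : vn ((E * Y) i) ≤ K * v := by
  have h1 : (WithLp.toLp 2 ((E * Y) i) : EuclideanSpace ℂ l)
      = ∑ j, E i j • (WithLp.toLp 2 (Y j) : EuclideanSpace ℂ l) := by
    ext k
    simp [Matrix.mul_apply]
  rw [vn, h1]
  refine (norm_sum_le _ _).trans ?_
  calc _ ≤ ∑ j, ‖E i j‖ * v := Finset.sum_le_sum fun j _ => by
        rw [norm_smul]; exact mul_le_mul_of_nonneg_left (hv j) (norm_nonneg _)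
    _ = (∑ j, ‖E i j‖) * v := by rw [Finset.sum_mul]
    _ ≤ K * v := mul_le_mul_of_nonneg_right hE hv0

lemma schur (E : Matrix m n ℂ) {K : ℝ} (hK : 0 ≤ K) (hr : ∀ i, ∑ j, ‖E i j‖ ≤ K)
    (hc : ∀ j, ∑ i, ‖E i j‖ ≤ K) : specNorm E ≤ K := by
  refine sn_le _ hK fun v => ?_
  refine abs_le_of_sq_le_sq' ?_ (mul_nonneg hK (vn_nonneg _)) |>.2
  rw [mul_pow, vn_sq, vn_sq]
  have h1 : ∀ i, ‖(E *ᵥ v) i‖ ^ 2 ≤ K * ∑ j, ‖E i j‖ * ‖v j‖ ^ 2 := by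
    intro i
    have : ‖(E *ᵥ v) i‖ ≤ ∑ j, ‖E i j‖ * ‖v j‖ := by
      refine (norm_sum_le _ _).trans (le_of_eq (Finset.sum_congr rfl fun j _ => ?_))
      exact norm_mul _ _
    calc ‖(E *ᵥ v) i‖ ^ 2 ≤ (∑ j, ‖E i j‖ * ‖v j‖) ^ 2 := by gcongr
      _ ≤ (∑ j, ‖E i j‖) * (∑ j, ‖E i j‖ * ‖v j‖ ^ 2) := by
        apply Finset.sum_sq_le_sum_mul_sum_of_sq_le_mul
        · intro j _; positivity
        · intro j _; positivity
        · intro j _; exact le_of_eq (by ring)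
      _ ≤ _ := mul_le_mul_of_nonneg_right (hr i)
        (Finset.sum_nonneg fun _ _ => by positivity)
  calc _ ≤ ∑ i, K * ∑ j, ‖E i j‖ * ‖v j‖ ^ 2 := Finset.sum_le_sum fun i _ => h1 i
    _ = K * ∑ j, (∑ i, ‖E i j‖) * ‖v j‖ ^ 2 := by
      rw [← Finset.mul_sum, Finset.sum_comm]
      simp_rw [Finset.sum_mul]
    _ ≤ K * ∑ j, K * ‖v j‖ ^ 2 := by
      refine mul_le_mul_of_nonneg_left (Finset.sum_le_sum fun j _ => ?_) hK
      exact mul_le_mul_of_nonneg_right (hc j) (by positivity)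
    _ = _ := by rw [← Finset.mul_sum]; ring

/-! Frobenius norm -/

lemma frob_sq (M : Matrix m n ℂ) : frobNorm M ^ 2 = (trace (Mᴴ * M)).re := by
  rw [frobNorm, Real.sq_sqrt (Finset.sum_nonneg fun _ _ => Finset.sum_nonneg fun _ _ => by
    positivity), Finset.sum_comm]
  simp only [trace, diag, mul_apply, Complex.re_sum, conjTranspose_apply]
  refine Finset.sum_congr rfl fun j _ => Finset.sum_congr rfl fun i _ => ?_
  simp only [RCLike.star_def, Complex.conj_mul']
  norm_cast

lemma frob_nonneg (M : Matrix m n ℂ) : 0 ≤ frobNorm M := Real.sqrt_nonneg _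

lemma frob_add (M M' : Matrix m n ℂ) :
    frobNorm (M + M') ^ 2 = frobNorm M ^ 2 + frobNorm M' ^ 2 + 2 * (trace (Mᴴ * M')).re := by
  have h : (trace (M'ᴴ * M)).re = (trace (Mᴴ * M')).re := by
    have : M'ᴴ * M = (Mᴴ * M')ᴴ := by simp
    rw [this, trace_conjTranspose]; simp
  simp only [frob_sq, conjTranspose_add, Matrix.add_mul, Matrix.mul_add, trace_add, Complex.add_re,
    h]
  ring

lemma frob_eq_zero {M : Matrix m n ℂ} (h : frobNorm M ^ 2 = 0) : M = 0 := by
  rw [frobNorm, Real.sq_sqrt (Finset.sum_nonneg fun _ _ => Finset.sum_nonneg fun _ _ => by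
    positivity)] at h
  ext i j
  rw [Finset.sum_eq_zero_iff_of_nonneg (fun _ _ => Finset.sum_nonneg fun _ _ => by
    positivity)] at h
  have h2 := h i (Finset.mem_univ _)
  rw [Finset.sum_eq_zero_iff_of_nonneg (fun _ _ => by positivity)] at h2
  simpa using h2 j (Finset.mem_univ _)

lemma frob_rankOne (a : m → ℂ) (w : n → ℂ) :
    frobNorm (vecMulVec a (star w)) ^ 2 = vn a ^ 2 * vn w ^ 2 := by
  rw [frobNorm, Real.sq_sqrt (Finset.sum_nonneg fun _ _ => Finset.sum_nonneg fun _ _ => by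
    positivity), vn_sq, vn_sq, Finset.sum_mul_sum]
  simp [vecMulVec_apply, mul_pow]

/-- If moving along `D` never decreases the norm, the first-order term vanishes. -/
lemma first_order (R D : Matrix m n ℂ) (h : ∀ t : ℝ, frobNorm R ≤ frobNorm (R + (t : ℂ) • D)) :
    (trace (Rᴴ * D)).re = 0 := by
  set b := (trace (Rᴴ * D)).re with hb
  have h1 : ∀ t : ℝ, 0 ≤ t ^ 2 * frobNorm D ^ 2 + 2 * (t * b) := by
    intro t
    have h2 := pow_le_pow_left₀ (frob_nonneg R) (h t) 2
    have h3 : frobNorm ((t : ℂ) • D) ^ 2 = t ^ 2 * frobNorm D ^ 2 := by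
      simp only [frob_sq, conjTranspose_smul, Matrix.smul_mul, Matrix.mul_smul, trace_smul, smul_eq_mul]
      rw [← mul_assoc]
      simp only [Complex.star_def, Complex.conj_ofReal]
      rw [← Complex.ofReal_mul, Complex.re_ofReal_mul]; ring
    rw [frob_add, h3, Matrix.mul_smul, trace_smul, smul_eq_mul, Complex.re_ofReal_mul] at h2
    linarith
  by_contra hne
  set d := frobNorm D ^ 2 with hd
  have hd0 : 0 ≤ d := by positivity
  have h4 := h1 (-b / (d + 1))
  have h5 : (-b / (d + 1)) ^ 2 * d + 2 * (-b / (d + 1) * b) = - (b ^ 2 * (d + 2)) / (d + 1) ^ 2 := by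
    field_simp; ring
  rw [h5] at h4
  have : 0 < b ^ 2 * (d + 2) / (d + 1) ^ 2 := by positivity
  rw [neg_div] at h4
  linarith

end

section
variable {m n r : ℕ}

lemma best_left {A L0 : Matrix (Fin m) (Fin n) ℂ} (h : IsBestRankApprox r A L0) :
    L0ᴴ * (A - L0) = 0 := by
  set R := A - L0 with hR
  have h1 := first_order R (L0 * (L0ᴴ * R)) fun t => by
    have := h.2 (L0 * (1 - (t : ℂ) • (L0ᴴ * R))) ((rank_mul_le_left _ _).trans h.1)
    convert this using 2
    have e : L0 * (1 - (t : ℂ) • (L0ᴴ * R)) = L0 - (t : ℂ) • (L0 * (L0ᴴ * R)) := by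
      rw [Matrix.mul_sub L0 1, Matrix.mul_one, Matrix.mul_smul]
    rw [e]
    simp only [hR]; abel
  apply frob_eq_zero
  rw [frob_sq, ← h1]
  simp [Matrix.mul_assoc]

lemma best_right {A L0 : Matrix (Fin m) (Fin n) ℂ} (h : IsBestRankApprox r A L0) :
    (A - L0) * L0ᴴ = 0 := by
  set R := A - L0 with hR
  have h1 := first_order R ((R * L0ᴴ) * L0) fun t => by
    have := h.2 ((1 - (t : ℂ) • (R * L0ᴴ)) * L0) ((rank_mul_le_right _ _).trans h.1)
    convert this using 2
    have e : (1 - (t : ℂ) • (R * L0ᴴ)) * L0 = L0 - (t : ℂ) • ((R * L0ᴴ) * L0) := by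
      rw [Matrix.sub_mul 1 _ L0, Matrix.one_mul, Matrix.smul_mul]
    rw [e]
    simp only [hR]; abel
  apply frob_eq_zero
  rw [frob_sq, ← h1]
  rw [← Matrix.mul_assoc Rᴴ (R * L0ᴴ) L0, trace_mul_comm _ L0, conjTranspose_mul,
    conjTranspose_conjTranspose, Matrix.mul_assoc]

/-- Exchange argument: the residual is dominated by each retained singular value. -/
lemma best_swap {A L0 : Matrix (Fin m) (Fin n) ℂ} (h : IsBestRankApprox r A L0)
    {Y : Matrix (Fin n) (Fin r) ℂ} (hY : Yᴴ * Y = 1) (hL : L0 * Y * Yᴴ = L0) (i : Fin r)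
    (w : Fin n → ℂ) (hw : vn w = 1) : vn ((A - L0) *ᵥ w) ≤ vn (L0 *ᵥ (Y.col i)) := by
  set R := A - L0 with hR
  have hLR : Rᴴ * L0 = 0 := by
    have := congrArg conjTranspose (best_left h)
    rw [conjTranspose_mul, conjTranspose_conjTranspose, conjTranspose_zero] at this
    exact this
  set y := Y.col i with hy
  have hyn : vn y = 1 := by
    have h1 := mulVec_iso hY (Pi.single i 1)
    rw [mulVec_single_one] at h1
    rw [hy, h1, vn_eq, Finset.sum_eq_single i]
    · simp
    · intro j _ hj; simp [hj]
    · simp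
  set G := vecMulVec (L0 *ᵥ y) (star y) with hG
  set W := vecMulVec (R *ᵥ w) (star w) with hW
  have hGe : G = L0 * vecMulVec y (star y) := by
    rw [hG, mul_vecMulVec]
  have hWe : W = R * vecMulVec w (star w) := by
    rw [hW, mul_vecMulVec]
  have hrank : (L0 - G + W).rank ≤ r := by
    have : L0 - G + W = ((L0 * Y).updateCol i (R *ᵥ w)) * ((Y.updateCol i w)ᴴ) := by
      ext a b
      have e1 : L0 a b = ∑ k, (L0 * Y) a k * star (Y b k) := by
        conv_lhs => rw [← hL]
        rw [Matrix.mul_apply]; rfl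
      have e2 : G a b = (L0 * Y) a i * star (Y b i) := by
        simp [hG, vecMulVec_apply, hy, Matrix.mulVec, Matrix.mul_apply, dotProduct]
      rw [Matrix.add_apply, Matrix.sub_apply, e1, e2,
        Matrix.mul_apply (M := (L0 * Y).updateCol i (R *ᵥ w))]
      rw [Finset.sum_eq_add_sum_sdiff_singleton_of_mem (Finset.mem_univ i),
        Finset.sum_eq_add_sum_sdiff_singleton_of_mem (Finset.mem_univ i)
          (fun j => (L0 * Y).updateCol i (R *ᵥ w) a j * (Y.updateCol i w)ᴴ j b)]
      have e3 : ∑ k ∈ Finset.univ \ {i}, (L0 * Y).updateCol i (R *ᵥ w) a k * (Y.updateCol i w)ᴴ k b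
          = ∑ k ∈ Finset.univ \ {i}, (L0 * Y) a k * star (Y b k) := by
        refine Finset.sum_congr rfl fun k hk => ?_
        have : k ≠ i := by simpa using hk
        simp [this]
      rw [e3]
      simp [hW, vecMulVec_apply]
      ring
    rw [this]
    refine (rank_mul_le_left _ _).trans ((rank_le_width _))
  have h2 := pow_le_pow_left₀ (frob_nonneg _) (h.2 _ hrank) 2
  have e : A - (L0 - G + W) = (R - W) + G := by rw [hR]; abel
  have hww : vecMulVec w (star w) * vecMulVec w (star w) = vecMulVec w (star w) := by
    rw [vecMulVec_mul_vecMulVec, vn_dot, hw]; simp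
  have hwh : (vecMulVec w (star w))ᴴ = vecMulVec w (star w) := by
    simp [conjTranspose_vecMulVec]
  have t1 : (R - W)ᴴ * G = 0 := by
    rw [hGe, hWe, conjTranspose_sub, conjTranspose_mul, Matrix.sub_mul, ← Matrix.mul_assoc, hLR,
      Matrix.mul_assoc, ← Matrix.mul_assoc Rᴴ, hLR]
    simp
  have t2 : trace ((R - W)ᴴ * W) = 0 := by
    rw [hWe, conjTranspose_sub, conjTranspose_mul, hwh, Matrix.sub_mul, trace_sub,
      Matrix.mul_assoc (vecMulVec w (star w)), trace_mul_comm (vecMulVec w (star w)),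
      ← Matrix.mul_assoc Rᴴ, Matrix.mul_assoc (Rᴴ * R), hww, sub_self]
  have f1 : frobNorm R ^ 2 = frobNorm (R - W) ^ 2 + frobNorm W ^ 2 := by
    have := frob_add (R - W) W
    rw [t2, sub_add_cancel] at this
    simpa using this
  rw [e, frob_add, t1, f1, hG, hW, frob_rankOne, frob_rankOne, hyn, hw] at h2
  simp only [trace_zero, Complex.zero_re] at h2
  refine (abs_le_of_sq_le_sq' ?_ (vn_nonneg _)).2
  linarith

lemma best_swap' {A L0 : Matrix (Fin m) (Fin n) ℂ} (h : IsBestRankApprox r A L0)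
    {Y : Matrix (Fin n) (Fin r) ℂ} (hY : Yᴴ * Y = 1) (hL : L0 * Y * Yᴴ = L0) (i : Fin r)
    (w : Fin n → ℂ) : vn ((A - L0) *ᵥ w) ≤ vn (L0 *ᵥ (Y.col i)) * vn w := by
  by_cases hw : w = 0
  · subst hw
    simp [vn]
  have hp := vn_pos hw
  have h1 := best_swap h hY hL i (((vn w)⁻¹ : ℝ) • w : Fin n → ℂ) (by
    have : (((vn w)⁻¹ : ℝ) • w : Fin n → ℂ) = (((vn w)⁻¹ : ℝ) : ℂ) • w := by ext; simp
    rw [this, vn_smul]; simp [abs_of_pos hp, hp.ne'])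
  have : (((vn w)⁻¹ : ℝ) • w : Fin n → ℂ) = (((vn w)⁻¹ : ℝ) : ℂ) • w := by ext; simp
  rw [this, mulVec_smul, vn_smul, Complex.norm_real, Real.norm_of_nonneg (by positivity),
    inv_mul_le_iff₀ hp] at h1
  linarith

open scoped ComplexOrder in
lemma exists_Y (M : Matrix (Fin m) (Fin n) ℂ) (hrn : r ≤ n) (hM : M.rank ≤ r) :
    ∃ (Y : Matrix (Fin n) (Fin r) ℂ) (lam : Fin r → ℝ), Yᴴ * Y = 1 ∧ M * Y * Yᴴ = M ∧
      Antitone lam ∧ (M * Y)ᴴ * (M * Y) = diagonal (fun i => (lam i : ℂ)) := by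
  have hH : (Mᴴ * M).IsHermitian := isHermitian_conjTranspose_mul_self M
  set W : Matrix (Fin n) (Fin n) ℂ := (hH.eigenvectorUnitary : Matrix (Fin n) (Fin n) ℂ) with hWd
  have hW1 : Wᴴ * W = 1 := Unitary.coe_star_mul_self hH.eigenvectorUnitary
  have hW2 : W * Wᴴ = 1 := Unitary.coe_mul_star_self hH.eigenvectorUnitary
  have hD : (M * W)ᴴ * (M * W) = diagonal (fun i => (hH.eigenvalues i : ℂ)) := by
    have h1 := hH.spectral_theorem
    rw [Unitary.conjStarAlgAut_apply] at h1
    change Mᴴ * M = W * _ * Wᴴ at h1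
    generalize hH.eigenvalues = ev at h1 ⊢
    rw [conjTranspose_mul, Matrix.mul_assoc, ← Matrix.mul_assoc Mᴴ, h1]
    rw [Matrix.mul_assoc W, Matrix.mul_assoc W, ← Matrix.mul_assoc Wᴴ W, hW1, Matrix.one_mul,
      Matrix.mul_assoc, hW1, Matrix.mul_one]
    rfl
  let e : Fin (Fintype.card (Fin n)) ≃ Fin n := Fintype.equivOfCardEq (Fintype.card_fin _)
  have hev : ∀ k, hH.eigenvalues k = hH.eigenvalues₀ (e.symm k) := fun k => rfl
  have hnn : ∀ k, 0 ≤ hH.eigenvalues k :=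
    fun k => (posSemidef_conjTranspose_mul_self M).eigenvalues_nonneg k
  have hc : r ≤ Fintype.card (Fin n) := by simpa using hrn
  let f : Fin r → Fin n := fun i => e (Fin.castLE hc i)
  have hf : Function.Injective f := e.injective.comp (Fin.castLE_injective hc)
  have hz : ∀ k, k ∉ Set.range f → hH.eigenvalues k = 0 := by
    intro k hk
    by_contra hne
    have hk' : r ≤ (e.symm k).1 := by
      by_contra hlt
      push Not at hlt
      exact hk ⟨⟨(e.symm k).1, hlt⟩, by simp [f]⟩
    have hpos : 0 < hH.eigenvalues k := lt_of_le_of_ne (hnn k) (Ne.symm hne)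
    have hcard : r + 1 ≤ Fintype.card {i // hH.eigenvalues i ≠ 0} := by
      have hi : Function.Injective (fun i : Fin (r + 1) =>
        (⟨e (Fin.castLE (by have := (e.symm k).2; omega) i), by
          rw [hev, Equiv.symm_apply_apply]
          refine ne_of_gt (lt_of_lt_of_le hpos ?_)
          rw [hev]
          apply hH.eigenvalues₀_antitone
          rw [Fin.le_def]
          simp only [Fin.val_castLE]
          have := i.2; omega⟩ : {i // hH.eigenvalues i ≠ 0})) := by
        intro a b hab
        simpa using hab
      simpa using Fintype.card_le_of_injective _ hi
    rw [← hH.rank_eq_card_non_zero_eigs, rank_conjTranspose_mul_self] at hcard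
    omega
  refine ⟨W.submatrix id f, fun i => hH.eigenvalues (f i), ?_, ?_, ?_, ?_⟩
  · have : (W.submatrix id f)ᴴ * W.submatrix id f = (Wᴴ * W).submatrix f f := by
      ext; simp [Matrix.mul_apply]
    rw [this, hW1, submatrix_one _ hf]
  · have hcol : ∀ k, k ∉ Set.range f → ∀ a, (M * W) a k = 0 := by
      intro k hk a
      have h1 : ((M * W)ᴴ * (M * W)) k k = 0 := by rw [hD]; simp [hz k hk]
      have h2 : star ((M * W).col k) ⬝ᵥ ((M * W).col k) = 0 := by
        rw [← h1, Matrix.mul_apply]; rfl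
      rw [dotProduct_star_self_eq_zero] at h2
      exact congrFun h2 a
    have : M = M * W * Wᴴ := by rw [Matrix.mul_assoc, hW2, Matrix.mul_one]
    conv_rhs => rw [this]
    ext a b
    rw [Matrix.mul_apply, Matrix.mul_apply]
    have e1 : ∀ k, (M * W.submatrix id f) a k * (W.submatrix id f)ᴴ k b
        = (fun k => (M * W) a k * Wᴴ k b) (f k) := by
      intro k; simp [Matrix.mul_apply]
    simp_rw [e1]
    rw [← Finset.sum_image (f := fun k => (M * W) a k * Wᴴ k b) (g := f) (s := Finset.univ) (fun _ _ _ _ h => hf h)]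
    refine Finset.sum_subset (Finset.subset_univ _) fun k _ hk => ?_
    rw [hcol k (by simpa using hk), zero_mul]
  · intro i j hij
    simp only [hev]
    apply hH.eigenvalues₀_antitone
    simpa [f] using hij
  · have : (M * W.submatrix id f)ᴴ * (M * W.submatrix id f) = ((M * W)ᴴ * (M * W)).submatrix f f := by
      ext; simp [Matrix.mul_apply]
    rw [this, hD, submatrix_diagonal _ _ hf]
    rfl

end

section
variable {m n r : ℕ}

lemma row_incoh {L E : Matrix (Fin m) (Fin n) ℂ} {U X : Matrix (Fin m) (Fin r) ℂ}
    {Y : Matrix (Fin n) (Fin r) ℂ} {D : Matrix (Fin r) (Fin r) ℂ} {K d q v : ℝ}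
    (hU : Uᴴ * U = 1) (hX : Xᴴ * X = 1) (hY : Yᴴ * Y = 1) (hL : U * (Uᴴ * L) = L)
    (hXD : (L + E) * Y * D = X) (hD : specNorm D ≤ d) (hK : 0 ≤ K) (hE : specNorm E ≤ K)
    (hEr : ∀ i, ∑ j, ‖E i j‖ ≤ K) (hq : ∀ i, vn (U i) ≤ q) (hv0 : 0 ≤ v)
    (hv : ∀ j, vn (Y j) ≤ v) (i : Fin m) :
    vn (X i) ≤ q * (1 + K * d) + K * v * d := by
  have h1 : X - E * Y * D = L * Y * D := by rw [← hXD]; simp [Matrix.add_mul]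
  have h2 : U * (Uᴴ * (X - E * Y * D)) + E * Y * D = X := by
    rw [h1, ← Matrix.mul_assoc Uᴴ, ← Matrix.mul_assoc Uᴴ, ← Matrix.mul_assoc U,
      ← Matrix.mul_assoc U, hL, ← h1, sub_add_cancel]
  have hEYD : specNorm (E * Y * D) ≤ K * d := by
    refine (sn_mul _ _).trans (mul_le_mul ?_ hD (sn_nonneg _) hK)
    refine (sn_mul _ _).trans ?_
    calc _ ≤ K * 1 := mul_le_mul hE (sn_iso hY) (sn_nonneg _) hK
      _ = K := mul_one K
  have hG : specNorm (Uᴴ * (X - E * Y * D)) ≤ 1 + K * d := by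
    refine (sn_mul _ _).trans ?_
    calc _ ≤ 1 * (1 + K * d) := mul_le_mul (sn_iso_conj hU)
          ((sn_sub _ _).trans (add_le_add (sn_iso hX) hEYD)) (sn_nonneg _) zero_le_one
      _ = _ := one_mul _
  have hq0 : 0 ≤ q := (vn_nonneg _).trans (hq i)
  rw [← h2]
  refine (vn_add ((U * (Uᴴ * (X - E * Y * D))) i) ((E * Y * D) i)).trans (add_le_add ?_ ?_)
  · exact (row_mul _ _ i).trans (mul_le_mul (hq i) hG (sn_nonneg _) hq0)
  · exact (row_mul _ _ i).trans (mul_le_mul (row_sparse E Y i hv0 (hEr i) hv) hD (sn_nonneg _)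
      (mul_nonneg hK hv0))

lemma vn_diag_ge {σ : Fin r → ℝ} {sr : ℝ} (h0 : 0 ≤ sr) (h : ∀ i, sr ≤ σ i) (b : Fin r → ℂ) :
    sr * vn b ≤ vn (diagonal (fun i => (σ i : ℂ)) *ᵥ b) := by
  refine (abs_le_of_sq_le_sq' ?_ (vn_nonneg _)).2
  rw [mul_pow, vn_sq, vn_sq, Finset.mul_sum]
  refine Finset.sum_le_sum fun i _ => ?_
  rw [mulVec_diagonal, norm_mul, mul_pow, Complex.norm_real, Real.norm_eq_abs, sq_abs]
  have := h i
  gcongr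

lemma col_norm {lam : Fin r → ℝ} {M : Matrix (Fin m) (Fin r) ℂ}
    (h : Mᴴ * M = diagonal (fun i => (lam i : ℂ))) (i : Fin r) : vn (M.col i) ^ 2 = lam i := by
  have h1 : (Mᴴ * M) i i = (lam i : ℂ) := by rw [h]; simp
  have h2 : star (M.col i) ⬝ᵥ (M.col i) = (lam i : ℂ) := by
    rw [← h1, Matrix.mul_apply]; rfl
  rw [vn_dot] at h2
  exact_mod_cast h2

lemma pyth {P R : Matrix (Fin m) (Fin n) ℂ} (h : Pᴴ * R = 0) (w : Fin n → ℂ) :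
    vn ((P + R) *ᵥ w) ^ 2 = vn (P *ᵥ w) ^ 2 + vn (R *ᵥ w) ^ 2 := by
  have h' : Rᴴ * P = 0 := by
    have := congrArg conjTranspose h
    simpa using this
  have : ((vn ((P + R) *ᵥ w) ^ 2 : ℝ) : ℂ) = ((vn (P *ᵥ w) ^ 2 + vn (R *ᵥ w) ^ 2 : ℝ) : ℂ) := by
    rw [Complex.ofReal_add]
    simp only [← vn_dot, star_mulVec, dotProduct_mulVec, vecMul_vecMul]
    rw [conjTranspose_add, Matrix.add_mul, Matrix.mul_add, Matrix.mul_add, h, h', add_zero,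
      zero_add, vecMul_add, add_dotProduct]
  exact_mod_cast this

lemma sv_lower {L E L0 : Matrix (Fin m) (Fin n) ℂ} {U : Matrix (Fin m) (Fin r) ℂ} {σ : Fin r → ℝ}
    {V : Matrix (Fin n) (Fin r) ℂ} (hS : IsSVD L U σ V) {sr K : ℝ} (hsr : 0 < sr)
    (hσ : ∀ i, sr ≤ σ i) (hE : specNorm E ≤ K)
    (hB : IsBestRankApprox r (L + E) L0) {Y : Matrix (Fin n) (Fin r) ℂ} (hY : Yᴴ * Y = 1)
    (hL : L0 * Y * Yᴴ = L0) (i : Fin r) : sr - K ≤ 2 * vn (L0 *ᵥ (Y.col i)) := by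
  obtain ⟨hU, hV, -, -, hLe⟩ := hS
  have hker : LinearMap.ker (Matrix.mulVecLin ((Yᴴ * V).submatrix
      (Subtype.val : {j : Fin r // j ≠ i} → Fin r) id)) ≠ ⊥ := by
    apply LinearMap.ker_ne_bot_of_finrank_lt
    have : Fintype.card {j : Fin r // j ≠ i} < Fintype.card (Fin r) :=
      Fintype.card_subtype_lt (x := i) (by simp)
    simpa using this
  obtain ⟨b, hb, hb0⟩ := (Submodule.ne_bot_iff _).1 hker
  rw [LinearMap.mem_ker, mulVecLin_apply] at hb
  set w := V *ᵥ b with hw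
  have hwn : vn w = vn b := mulVec_iso hV b
  have hp : 0 < vn b := vn_pos hb0
  have hYw : ∀ j, j ≠ i → (Yᴴ *ᵥ w) j = 0 := by
    intro j hj
    have := congrFun hb ⟨j, hj⟩
    rw [hw, mulVec_mulVec]
    exact this
  have hLw : sr * vn b ≤ vn (L *ᵥ w) := by
    rw [hLe, hw, ← mulVec_mulVec, ← mulVec_mulVec, mulVec_mulVec _ Vᴴ V, hV, one_mulVec,
      mulVec_iso hU]
    exact vn_diag_ge hsr.le hσ b
  have hEw : vn (E *ᵥ w) ≤ K * vn b := by
    rw [← hwn]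
    exact (sn_mulVec E w).trans (mul_le_mul_of_nonneg_right hE (vn_nonneg _))
  have hYe : Yᴴ *ᵥ w = (Yᴴ *ᵥ w) i • Pi.single i 1 := by
    ext j
    by_cases hj : j = i
    · subst hj; simp
    · simp [hYw j hj, hj]
  have hL0w : vn (L0 *ᵥ w) ≤ vn (L0 *ᵥ (Y.col i)) * vn b := by
    have e : L0 *ᵥ w = (Yᴴ *ᵥ w) i • (L0 *ᵥ (Y.col i)) := by
      conv_lhs => rw [← hL]
      rw [← mulVec_mulVec, ← mulVec_mulVec, hYe, mulVec_smul, mulVec_single_one, mulVec_smul]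
      simp
    rw [e, vn_smul, mul_comm]
    refine mul_le_mul_of_nonneg_left ?_ (vn_nonneg _)
    refine (vn_apply _ i).trans ((sn_mulVec _ _).trans ?_)
    rw [hwn]
    calc _ ≤ 1 * vn b := mul_le_mul_of_nonneg_right (sn_iso_conj hY) hp.le
      _ = _ := one_mul _
  have hRw := best_swap' hB hY hL i w
  rw [hwn] at hRw
  have e : L *ᵥ w = L0 *ᵥ w + (L + E - L0) *ᵥ w - E *ᵥ w := by
    rw [← add_mulVec, ← sub_mulVec]; congr 1; abel
  have h3 : vn (L *ᵥ w) ≤ vn (L0 *ᵥ w) + vn ((L + E - L0) *ᵥ w) + vn (E *ᵥ w) := by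
    rw [e]
    exact (vn_sub _ _).trans (by gcongr; exact vn_add _ _)
  have h4 : (sr - K) * vn b ≤ (2 * vn (L0 *ᵥ (Y.col i))) * vn b := by linarith
  exact le_of_mul_le_mul_right h4 hp

lemma resid_Y {A L0 : Matrix (Fin m) (Fin n) ℂ} (hB : IsBestRankApprox r A L0)
    {X : Matrix (Fin m) (Fin r) ℂ} {S : Fin r → ℝ} {Y : Matrix (Fin n) (Fin r) ℂ}
    (hS0 : IsSVD L0 X S Y) : (A - L0) * Y = 0 := by
  obtain ⟨hX, hY, hSp, hSm, hL0⟩ := hS0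
  have hb := best_right hB
  set R := A - L0 with hR
  have h1 : R * L0ᴴ * X * diagonal (fun i => ((S i)⁻¹ : ℂ)) = 0 := by
    rw [hb]; simp
  have h2 : (diagonal (fun i => (S i : ℂ)))ᴴ = diagonal (fun i => (S i : ℂ)) := by
    rw [diagonal_conjTranspose]; congr 1; ext i; simp
  have h3 : diagonal (fun i => (S i : ℂ)) * diagonal (fun i => ((S i)⁻¹ : ℂ)) = 1 := by
    rw [diagonal_mul_diagonal, ← diagonal_one]; congr 1; ext i
    exact mul_inv_cancel₀ (by exact_mod_cast (hSp i).ne')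
  rw [hL0, conjTranspose_mul, conjTranspose_mul, conjTranspose_conjTranspose, h2] at h1
  simp only [Matrix.mul_assoc] at h1
  rw [← Matrix.mul_assoc Xᴴ, hX, Matrix.one_mul, h3, Matrix.mul_one] at h1
  exact h1

lemma resid_le {L E L0 : Matrix (Fin m) (Fin n) ℂ} {U : Matrix (Fin m) (Fin r) ℂ} {σ : Fin r → ℝ}
    {V : Matrix (Fin n) (Fin r) ℂ} (hS : IsSVD L U σ V) {K : ℝ} (hK : 0 ≤ K)
    (hE : specNorm E ≤ K) (hB : IsBestRankApprox r (L + E) L0)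
    {X : Matrix (Fin m) (Fin r) ℂ} {S : Fin r → ℝ} {Y : Matrix (Fin n) (Fin r) ℂ}
    (hS0 : IsSVD L0 X S Y) : specNorm (L + E - L0) ≤ K := by
  obtain ⟨hU, hV, -, -, hLe⟩ := hS
  obtain ⟨hX, hY, hSp, hSm, hL0⟩ := hS0
  set R := L + E - L0 with hR
  have hRL : L0ᴴ * R = 0 := best_left hB
  have hLY : L0 * Y * Yᴴ = L0 := by
    rw [hL0]; simp only [Matrix.mul_assoc]; rw [← Matrix.mul_assoc Yᴴ Y, hY, Matrix.one_mul]
  have hLYX : L0 * Y = X * diagonal (fun i => (S i : ℂ)) := by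
    rw [hL0]; simp only [Matrix.mul_assoc]; rw [hY, Matrix.mul_one]
  have hRY : R * Y = 0 := resid_Y hB ⟨hX, hY, hSp, hSm, hL0⟩
  refine sn_le _ hK fun q0 => ?_
  by_cases hq0 : q0 = 0
  · subst hq0; simp [vn]
  set q := q0 - Y *ᵥ (Yᴴ *ᵥ q0) with hq
  have hYq : Yᴴ *ᵥ q = 0 := by
    rw [hq, mulVec_sub, mulVec_mulVec, hY, one_mulVec, sub_self]
  have hRq : R *ᵥ q0 = R *ᵥ q := by
    rw [hq, mulVec_sub, mulVec_mulVec, hRY, zero_mulVec, sub_zero]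
  have hort : ∀ b : Fin r → ℂ, ∀ β : ℂ, vn (Y *ᵥ b + β • q) ^ 2 = vn b ^ 2 + ‖β‖ ^ 2 * vn q ^ 2 := by
    intro b β
    have h1 : star (Y *ᵥ b) ⬝ᵥ q = 0 := by
      rw [star_mulVec, ← dotProduct_mulVec, hYq, dotProduct_zero]
    have h2 : star q ⬝ᵥ (Y *ᵥ b) = 0 := by
      rw [star_dotProduct, h1, star_zero]
    have : ((vn (Y *ᵥ b + β • q) ^ 2 : ℝ) : ℂ) = ((vn (Y *ᵥ b) ^ 2 + vn (β • q) ^ 2 : ℝ) : ℂ) := by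
      rw [Complex.ofReal_add]
      simp only [← vn_dot, star_add, star_smul, add_dotProduct, dotProduct_add, smul_dotProduct,
        dotProduct_smul, h1, h2, smul_zero, add_zero, zero_add]
    have h3 : vn (Y *ᵥ b + β • q) ^ 2 = vn (Y *ᵥ b) ^ 2 + vn (β • q) ^ 2 := by exact_mod_cast this
    rw [h3, mulVec_iso hY, vn_smul, mul_pow]
  have hqn : vn q ≤ vn q0 := by
    have h1 := hort (Yᴴ *ᵥ q0) 1
    have h2 : Y *ᵥ (Yᴴ *ᵥ q0) + (1 : ℂ) • q = q0 := by rw [hq, one_smul]; abel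
    rw [h2] at h1
    refine (abs_le_of_sq_le_sq' ?_ (vn_nonneg _)).2
    rw [h1]; simp; positivity
  have hρS : ∀ i, vn (R *ᵥ q) ≤ S i * vn q0 := by
    intro i
    have h1 := best_swap' hB hY hLY i q
    have h2 : vn (L0 *ᵥ (Y.col i)) = S i := by
      rw [← mulVec_single_one Y i, mulVec_mulVec, hLYX, ← mulVec_mulVec, mulVec_iso hX,
        vn_eq, Finset.sum_eq_single i]
      · simp [mulVec_diagonal, Real.sqrt_sq (hSp i).le]
      · intro j _ hj; simp [mulVec_diagonal, hj]
      · simp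
    rw [h2] at h1
    exact h1.trans (mul_le_mul_of_nonneg_left hqn (hSp i).le)
  let f : ((Fin r → ℂ) × ℂ) →ₗ[ℂ] (Fin r → ℂ) :=
    (Matrix.mulVecLin (Vᴴ * Y)).coprod (LinearMap.toSpanSingleton ℂ _ (Vᴴ *ᵥ q))
  have hker : LinearMap.ker f ≠ ⊥ := by
    apply LinearMap.ker_ne_bot_of_finrank_lt
    simp
  obtain ⟨⟨b, β⟩, hb, hb0⟩ := (Submodule.ne_bot_iff _).1 hker
  set w := Y *ᵥ b + β • q with hw
  have hVw : Vᴴ *ᵥ w = 0 := by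
    rw [LinearMap.mem_ker] at hb
    rw [hw, mulVec_add, mulVec_smul, mulVec_mulVec]
    simpa [f] using hb
  have hLw : L *ᵥ w = 0 := by
    rw [hLe, ← mulVec_mulVec, hVw, mulVec_zero]
  have hAw : (L0 + R) *ᵥ w = E *ᵥ w := by
    have : L0 + R = L + E := by rw [hR]; abel
    rw [this, add_mulVec, hLw, zero_add]
  have hP := pyth hRL w
  have hL0w : L0 *ᵥ w = X *ᵥ (diagonal (fun i => (S i : ℂ)) *ᵥ b) := by
    rw [hL0, ← mulVec_mulVec, hw, mulVec_add, mulVec_smul, hYq, smul_zero, add_zero,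
      mulVec_mulVec _ Yᴴ Y, hY, one_mulVec, mulVec_mulVec]
  have hRw : R *ᵥ w = β • (R *ᵥ q) := by
    rw [hw, mulVec_add, mulVec_mulVec, hRY, zero_mulVec, zero_add, mulVec_smul]
  rw [hAw, hL0w, hRw, mulVec_iso hX, vn_smul] at hP
  have hEw : vn (E *ᵥ w) ^ 2 ≤ (K * vn w) ^ 2 := by
    have := (sn_mulVec E w).trans (mul_le_mul_of_nonneg_right hE (vn_nonneg w))
    exact pow_le_pow_left₀ (vn_nonneg _) this 2
  have hwn := hort b β
  rw [← hw] at hwn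
  set ρ := vn (R *ᵥ q) with hρ
  have hq0p : 0 < vn q0 := vn_pos hq0
  have hd : (ρ / vn q0) * vn b ≤ vn (diagonal (fun i => (S i : ℂ)) *ᵥ b) :=
    vn_diag_ge (div_nonneg (vn_nonneg _) hq0p.le)
      (fun i => (div_le_iff₀ hq0p).2 (hρS i)) b
  have hd2 := pow_le_pow_left₀ (mul_nonneg (div_nonneg (vn_nonneg _) hq0p.le) (vn_nonneg _)) hd 2
  have hT : 0 < vn b ^ 2 + ‖β‖ ^ 2 * vn q0 ^ 2 := by
    by_cases h0 : b = 0
    · have : β ≠ 0 := by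
        rintro rfl; exact hb0 (by rw [h0]; rfl)
      have : 0 < ‖β‖ := norm_pos_iff.2 this
      positivity
    · have := vn_pos h0
      positivity
  have hqn2 := pow_le_pow_left₀ (vn_nonneg _) hqn 2
  have hmain : (ρ / vn q0) ^ 2 * (vn b ^ 2 + ‖β‖ ^ 2 * vn q0 ^ 2)
      ≤ K ^ 2 * (vn b ^ 2 + ‖β‖ ^ 2 * vn q0 ^ 2) := by
    have e1 : (ρ / vn q0) ^ 2 * (vn b ^ 2 + ‖β‖ ^ 2 * vn q0 ^ 2)
        = (ρ / vn q0 * vn b) ^ 2 + (‖β‖ * ρ) ^ 2 := by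
      field_simp
    rw [e1]
    calc _ ≤ vn (E *ᵥ w) ^ 2 := by rw [hP]; linarith
      _ ≤ (K * vn w) ^ 2 := hEw
      _ = K ^ 2 * (vn b ^ 2 + ‖β‖ ^ 2 * vn q ^ 2) := by rw [mul_pow, hwn]
      _ ≤ _ := by gcongr
  have h5 := le_of_mul_le_mul_right hmain hT
  have h6 := (abs_le_of_sq_le_sq' h5 hK).2
  rw [hRq]
  exact (div_le_iff₀ hq0p).1 h6

end

section
variable {m n r : ℕ}

lemma diag_real_conj (S : Fin r → ℝ) :
    (diagonal (fun i => (S i : ℂ)))ᴴ = diagonal (fun i => (S i : ℂ)) := by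
  rw [diagonal_conjTranspose]; congr 1; ext i; simp

lemma iso_width {V : Matrix (Fin n) (Fin r) ℂ} (hV : Vᴴ * V = 1) : r ≤ n := by
  have h1 : (Vᴴ * V).rank = r := by rw [hV, rank_one]; simp
  rw [← h1]
  exact (rank_mul_le_right _ _).trans (by simpa using rank_le_card_height V)

lemma exists_svd {L E L0 : Matrix (Fin m) (Fin n) ℂ} {U : Matrix (Fin m) (Fin r) ℂ}
    {σ : Fin r → ℝ} {V : Matrix (Fin n) (Fin r) ℂ} (hS : IsSVD L U σ V) {sr K : ℝ} (hsr : 0 < sr)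
    (hσ : ∀ i, sr ≤ σ i) (hE : specNorm E ≤ K) (hKs : K < sr)
    (hB : IsBestRankApprox r (L + E) L0) :
    ∃ (X : Matrix (Fin m) (Fin r) ℂ) (S : Fin r → ℝ) (Y : Matrix (Fin n) (Fin r) ℂ),
      IsSVD L0 X S Y ∧ ∀ i, (sr - K) / 2 ≤ S i := by
  obtain ⟨Y, lam, hY, hLY, hanti, hdiag⟩ := exists_Y (r := r) L0 (iso_width hS.2.1) hB.1
  have hcol : ∀ i, vn (L0 *ᵥ (Y.col i)) = Real.sqrt (lam i) := by
    intro i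
    rw [← col_norm hdiag i, Real.sqrt_sq (vn_nonneg _)]
    congr 1
  have hlow : ∀ i, (sr - K) / 2 ≤ Real.sqrt (lam i) := by
    intro i
    have := sv_lower hS hsr hσ hE hB hY hLY i
    rw [hcol] at this
    linarith
  have hpos : ∀ i, 0 < Real.sqrt (lam i) := fun i => lt_of_lt_of_le (by linarith) (hlow i)
  have hne : ∀ i, ((Real.sqrt (lam i) : ℝ) : ℂ) ≠ 0 := fun i => by exact_mod_cast (hpos i).ne'
  refine ⟨L0 * Y * diagonal (fun i => (((Real.sqrt (lam i))⁻¹ : ℝ) : ℂ)),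
    fun i => Real.sqrt (lam i), Y, ⟨?_, hY, hpos, ?_, ?_⟩, hlow⟩
  · rw [conjTranspose_mul, diag_real_conj, Matrix.mul_assoc, ← Matrix.mul_assoc (L0 * Y)ᴴ, hdiag,
      diagonal_mul_diagonal, diagonal_mul_diagonal, ← diagonal_one]
    congr 1
    ext i
    have h1 : lam i = Real.sqrt (lam i) * Real.sqrt (lam i) :=
      (Real.mul_self_sqrt (Real.sqrt_pos.1 (hpos i)).le).symm
    have h2 : ((lam i : ℝ) : ℂ) = (Real.sqrt (lam i) : ℂ) * (Real.sqrt (lam i) : ℂ) := by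
      exact_mod_cast h1
    rw [h2]
    have := hne i
    push_cast
    field_simp
  · intro i j hij
    exact Real.sqrt_le_sqrt (hanti hij)
  · have : diagonal (fun i => (((Real.sqrt (lam i))⁻¹ : ℝ) : ℂ)) *
        diagonal (fun i => ((Real.sqrt (lam i) : ℝ) : ℂ)) = 1 := by
      rw [diagonal_mul_diagonal, ← diagonal_one]; congr 1; ext i
      push_cast
      exact inv_mul_cancel₀ (hne i)
    rw [Matrix.mul_assoc (L0 * Y), this, Matrix.mul_one, hLY]

lemma sn_diag_le {S : Fin r → ℝ} {d : ℝ} (hd : 0 ≤ d) (h : ∀ i, |S i| ≤ d) :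
    specNorm (diagonal (fun i => (S i : ℂ))) ≤ d := by
  refine sn_le _ hd fun v => ?_
  refine (abs_le_of_sq_le_sq' ?_ (mul_nonneg hd (vn_nonneg _))).2
  rw [mul_pow, vn_sq, vn_sq, Finset.mul_sum]
  refine Finset.sum_le_sum fun i _ => ?_
  rw [mulVec_diagonal, norm_mul, mul_pow, Complex.norm_real, Real.norm_eq_abs]
  have := h i
  gcongr

lemma exists_row_bound (X : Matrix (Fin m) (Fin r) ℂ) (hm : 0 < m) :
    ∃ i, ∀ k, vn (X k) ≤ vn (X i) := by
  have : Nonempty (Fin m) := ⟨⟨0, hm⟩⟩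
  exact Finite.exists_max fun i => vn (X i)

lemma core (hm : 0 < m) (hn : 0 < n)
    {L E L0 : Matrix (Fin m) (Fin n) ℂ} {U : Matrix (Fin m) (Fin r) ℂ}
    {σ : Fin r → ℝ} {V : Matrix (Fin n) (Fin r) ℂ} (hS : IsSVD L U σ V) {sr K q : ℝ} (hsr : 0 < sr)
    (hσ : ∀ i, sr ≤ σ i) (hK : 0 ≤ K) (hKs : 50 * K ≤ sr) (hEr : ∀ i, ∑ j, ‖E i j‖ ≤ K)
    (hEc : ∀ j, ∑ i, ‖E i j‖ ≤ K) (hUq : ∀ i, vn (U i) ≤ q) (hVq : ∀ i, vn (V i) ≤ q)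
    (hB : IsBestRankApprox r (L + E) L0) :
    specNorm (L - L0) ≤ 2 * K ∧ (∀ i j, ‖(L - L0) i j‖ ≤ 8 * K * q ^ 2) ∧
    ∃ (X : Matrix (Fin m) (Fin r) ℂ) (S : Fin r → ℝ) (Y : Matrix (Fin n) (Fin r) ℂ),
      IsSVD L0 X S Y ∧ (∀ i, vn (X i) ≤ 2 * q) ∧ (∀ i, vn (Y i) ≤ 2 * q) := by
  have hE : specNorm E ≤ K := schur E hK hEr hEc
  have hEt : specNorm Eᴴ ≤ K := by rw [sn_conj]; exact hE
  have hq0 : 0 ≤ q := (vn_nonneg _).trans (hUq ⟨0, hm⟩)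
  obtain ⟨X, S, Y, hS0, hlow⟩ := exists_svd hS hsr hσ hE (by linarith) hB
  have hres := resid_le hS hK hE hB hS0
  have hRY := resid_Y hB hS0
  have hLR := best_left hB
  have hS0' := hS0
  obtain ⟨hX, hY, hSp, hSm, hL0⟩ := hS0
  obtain ⟨hU, hV, hσp, hσm, hLe⟩ := hS
  have hmain : specNorm (L - L0) ≤ 2 * K := by
    have : L - L0 = (L + E - L0) - E := by abel
    rw [this]
    exact (sn_sub _ _).trans (by linarith)
  -- relations
  set T0 := diagonal (fun i => (S i : ℂ)) with hT0
  set D : Matrix (Fin r) (Fin r) ℂ := diagonal (fun i => (((S i)⁻¹ : ℝ) : ℂ)) with hD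
  have hSne : ∀ i, (S i : ℂ) ≠ 0 := fun i => by exact_mod_cast (hSp i).ne'
  have hTD : T0 * D = 1 := by
    rw [hT0, hD, diagonal_mul_diagonal, ← diagonal_one]; congr 1; ext i
    push_cast
    exact mul_inv_cancel₀ (hSne i)
  have hAY : (L + E) * Y = X * T0 := by
    have h1 : (L + E) * Y = L0 * Y := by
      rw [← sub_eq_zero, ← Matrix.sub_mul]; exact hRY
    rw [h1, hL0, Matrix.mul_assoc, hY, Matrix.mul_one]
  have hL0h : L0ᴴ = Y * T0 * Xᴴ := by
    rw [hL0, conjTranspose_mul, conjTranspose_mul, conjTranspose_conjTranspose, diag_real_conj,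
      Matrix.mul_assoc]
  have hDT : D * T0 = 1 := by
    rw [hT0, hD, diagonal_mul_diagonal, ← diagonal_one]; congr 1; ext i
    push_cast
    exact inv_mul_cancel₀ (hSne i)
  have hXR : Xᴴ * (L + E - L0) = 0 := by
    have h1 : D * Yᴴ * (L0ᴴ * (L + E - L0)) = 0 := by rw [hLR, Matrix.mul_zero]
    have h2 : D * Yᴴ * L0ᴴ = Xᴴ := by
      rw [hL0h, Matrix.mul_assoc Y, Matrix.mul_assoc D, ← Matrix.mul_assoc Yᴴ, hY, Matrix.one_mul,
        ← Matrix.mul_assoc, hDT, Matrix.one_mul]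
    rwa [← Matrix.mul_assoc, h2] at h1
  have hXA : Xᴴ * (L + E) = T0 * Yᴴ := by
    have h1 : Xᴴ * (L + E) = Xᴴ * L0 := by
      rw [← sub_eq_zero, ← Matrix.mul_sub]; exact hXR
    rw [h1, hL0, Matrix.mul_assoc, ← Matrix.mul_assoc, hX, Matrix.one_mul]
  have hAX : (Lᴴ + Eᴴ) * X = Y * T0 := by
    have := congrArg conjTranspose hXA
    rw [conjTranspose_mul, conjTranspose_mul, conjTranspose_add, conjTranspose_conjTranspose,
      conjTranspose_conjTranspose, diag_real_conj] at this
    exact this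
  have hUL : U * (Uᴴ * L) = L := by
    rw [hLe, Matrix.mul_assoc U, ← Matrix.mul_assoc Uᴴ, hU, Matrix.one_mul]
  have hLV : L * V * Vᴴ = L := by
    rw [hLe, Matrix.mul_assoc, Matrix.mul_assoc, ← Matrix.mul_assoc Vᴴ, hV, Matrix.one_mul]
  have hVL : V * (Vᴴ * Lᴴ) = Lᴴ := by
    have := congrArg conjTranspose hLV
    rwa [conjTranspose_mul, conjTranspose_mul, conjTranspose_conjTranspose] at this
  set d := 2 / (sr - K) with hd
  have hd0 : 0 < d := by
    apply div_pos two_pos; linarith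
  have hDn : specNorm D ≤ d := by
    refine sn_diag_le hd0.le fun i => ?_
    have := hSp i
    rw [abs_of_pos (by positivity), hd, inv_le_comm₀ this (by rw [← hd]; exact hd0), inv_div]
    exact hlow i
  have hKd : K * d ≤ 1 / 24 := by
    rw [hd, mul_div_assoc', div_le_div_iff₀ (by linarith) (by norm_num)]
    linarith
  have hKd0 : 0 ≤ K * d := mul_nonneg hK hd0.le
  obtain ⟨i0, hi0⟩ := exists_row_bound X hm
  obtain ⟨j0, hj0⟩ := exists_row_bound Y hn
  set M := max (vn (X i0)) (vn (Y j0)) with hM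
  have hXM : ∀ i, vn (X i) ≤ M := fun i => (hi0 i).trans (le_max_left _ _)
  have hYM : ∀ i, vn (Y i) ≤ M := fun i => (hj0 i).trans (le_max_right _ _)
  have hM0 : 0 ≤ M := (vn_nonneg _).trans (hXM i0)
  have hXb : ∀ i, vn (X i) ≤ q * (1 + K * d) + K * M * d := fun i =>
    row_incoh hU hX hY hUL (by rw [hAY, Matrix.mul_assoc, hTD, Matrix.mul_one]) hDn hK hE hEr hUq
      hM0 hYM i
  have hEtr : ∀ i, ∑ j, ‖Eᴴ i j‖ ≤ K := by
    intro i; simpa using hEc i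
  have hYb : ∀ i, vn (Y i) ≤ q * (1 + K * d) + K * M * d := fun i =>
    row_incoh hV hY hX hVL (by rw [hAX, Matrix.mul_assoc, hTD, Matrix.mul_one]) hDn hK hEt hEtr hVq
      hM0 hXM i
  have hMb : M ≤ q * (1 + K * d) + K * M * d := max_le (hXb i0) (hYb j0)
  have hMq : M ≤ 6 / 5 * q := by
    have h1 : q * (K * d) ≤ q * (1 / 24) := mul_le_mul_of_nonneg_left hKd hq0
    have h2 : M * (K * d) ≤ M * (1 / 24) := mul_le_mul_of_nonneg_left hKd hM0
    linarith
  refine ⟨hmain, ?_, X, S, Y, hS0', fun i => (hXM i).trans (by linarith),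
    fun i => (hYM i).trans (by linarith)⟩
  intro i j
  have hL0Y : L0 = (L + E) * Y * Yᴴ := by rw [hAY, hL0]
  have hL0X : L0 = X * (Xᴴ * (L + E)) := by rw [hXA, hL0, Matrix.mul_assoc]
  have hd1 : L0 - U * (Uᴴ * L0) = E * Y * Yᴴ - U * (Uᴴ * E * Y) * Yᴴ := by
    have e1 : U * (Uᴴ * L0) = (L + U * (Uᴴ * E)) * Y * Yᴴ := by
      rw [hL0Y]
      conv_rhs => rw [← hUL]
      simp only [Matrix.mul_assoc, Matrix.add_mul, Matrix.mul_add]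
    rw [e1]
    conv_lhs => rw [hL0Y]
    simp only [Matrix.mul_assoc, Matrix.add_mul]
    abel
  have hd2 : L0 - L0 * V * Vᴴ = X * (Xᴴ * E) - X * (Xᴴ * E * V * Vᴴ) := by
    have e1 : L0 * V * Vᴴ = X * (Xᴴ * (L + E * V * Vᴴ)) := by
      rw [hL0X]
      conv_rhs => rw [← hLV]
      simp only [Matrix.mul_assoc, Matrix.add_mul, Matrix.mul_add]
    rw [e1]
    conv_lhs => rw [hL0X]
    simp only [Matrix.mul_assoc, Matrix.mul_add]
    abel
  have hdec : L - L0 = U * (Uᴴ * (L - L0) * V) * Vᴴ - (E * Y * Yᴴ - U * (Uᴴ * E * Y) * Yᴴ)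
      - (U * (Uᴴ * X) * (Eᴴ * X)ᴴ - U * (Uᴴ * X * (Xᴴ * E * V)) * Vᴴ) := by
    have e2 : U * (Uᴴ * X) * (Eᴴ * X)ᴴ - U * (Uᴴ * X * (Xᴴ * E * V)) * Vᴴ
        = U * (Uᴴ * (L0 - L0 * V * Vᴴ)) := by
      rw [hd2, conjTranspose_mul, conjTranspose_conjTranspose]
      simp only [Matrix.mul_assoc, Matrix.mul_sub]
    have e3 : U * (Uᴴ * (L - L0) * V) * Vᴴ = L - U * (Uᴴ * (L0 * V * Vᴴ)) := by
      have : U * (Uᴴ * (L * V * Vᴴ)) = L := by rw [hLV, hUL]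
      rw [← this]
      simp only [Matrix.mul_assoc, Matrix.mul_sub, Matrix.sub_mul]
      have h7 : V * (Vᴴ * (V * Vᴴ)) = V * Vᴴ := by
        rw [← Matrix.mul_assoc Vᴴ, hV, Matrix.one_mul]
      have h8 : U * (Uᴴ * (U * (Uᴴ * (L * (V * (Vᴴ * (V * Vᴴ))))))) = U * (Uᴴ * (L * (V * Vᴴ))) := by
        rw [h7, ← Matrix.mul_assoc Uᴴ U, hU, Matrix.one_mul]
      rw [h8]
    rw [← hd1, e2, e3, Matrix.mul_sub, Matrix.mul_sub]
    abel
  have nUE : ∀ {Z : Matrix (Fin m) (Fin r) ℂ} {Z' : Matrix (Fin n) (Fin r) ℂ},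
      Zᴴ * Z = 1 → Z'ᴴ * Z' = 1 → ∀ {F : Matrix (Fin m) (Fin n) ℂ} {k : ℝ}, specNorm F ≤ k →
      specNorm (Zᴴ * F * Z') ≤ k := by
    intro Z Z' hZ hZ' F k hF
    have hk : 0 ≤ k := (sn_nonneg _).trans hF
    calc specNorm (Zᴴ * F * Z') ≤ specNorm (Zᴴ * F) * specNorm Z' := sn_mul _ _
      _ ≤ (specNorm Zᴴ * specNorm F) * specNorm Z' :=
        mul_le_mul_of_nonneg_right (sn_mul _ _) (sn_nonneg _)
      _ ≤ (1 * k) * 1 := by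
        refine mul_le_mul ?_ (sn_iso hZ') (sn_nonneg _) (by linarith)
        exact mul_le_mul (sn_iso_conj hZ) hF (sn_nonneg _) zero_le_one
      _ = k := by ring
  have nUX : specNorm (Uᴴ * X) ≤ 1 := by
    calc specNorm (Uᴴ * X) ≤ specNorm Uᴴ * specNorm X := sn_mul _ _
      _ ≤ 1 * 1 := mul_le_mul (sn_iso_conj hU) (sn_iso hX) (sn_nonneg _) zero_le_one
      _ = 1 := one_mul 1
  have key : ∀ {Z : Matrix (Fin m) (Fin r) ℂ} {Z' : Matrix (Fin n) (Fin r) ℂ} {a b : ℝ},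
      vn (Z i) ≤ a → vn (Z' j) ≤ b → ‖(Z * Z'ᴴ) i j‖ ≤ a * b := by
    intro Z Z' a b ha hb
    exact (entry_mul Z Z' i j).trans (mul_le_mul ha hb (vn_nonneg _) ((vn_nonneg _).trans ha))
  have rowU : ∀ {G : Matrix (Fin r) (Fin r) ℂ} {k : ℝ}, specNorm G ≤ k →
      vn ((U * G) i) ≤ q * k := by
    intro G k hG
    exact (row_mul U G i).trans (mul_le_mul (hUq i) hG (sn_nonneg _) hq0)
  have b1 : ‖(U * (Uᴴ * (L - L0) * V) * Vᴴ) i j‖ ≤ q * (2 * K) * q :=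
    key (rowU (nUE hU hV hmain)) (hVq j)
  have b2 : ‖(E * Y * Yᴴ) i j‖ ≤ K * M * M := key (row_sparse E Y i hM0 (hEr i) hYM) (hYM j)
  have b3 : ‖(U * (Uᴴ * E * Y) * Yᴴ) i j‖ ≤ q * K * M := key (rowU (nUE hU hY hE)) (hYM j)
  have b4 : ‖(U * (Uᴴ * X) * (Eᴴ * X)ᴴ) i j‖ ≤ q * 1 * (K * M) :=
    key (rowU nUX) (row_sparse Eᴴ X j hM0 (hEtr j) hXM)
  have b5 : ‖(U * (Uᴴ * X * (Xᴴ * E * V)) * Vᴴ) i j‖ ≤ q * K * q := by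
    refine key (rowU ?_) (hVq j)
    calc _ ≤ specNorm (Uᴴ * X) * specNorm (Xᴴ * E * V) := sn_mul _ _
      _ ≤ 1 * K := mul_le_mul nUX (nUE hX hV hE) (sn_nonneg _) zero_le_one
      _ = K := one_mul K
  have htot : ‖(L - L0) i j‖ ≤ q * (2 * K) * q + (K * M * M + q * K * M)
      + (q * 1 * (K * M) + q * K * q) := by
    rw [hdec]
    simp only [Matrix.sub_apply]
    refine (norm_sub_le _ _).trans (add_le_add ((norm_sub_le _ _).trans (add_le_add b1 ?_)) ?_)
    · exact (norm_sub_le _ _).trans (add_le_add b2 b3)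
    · exact (norm_sub_le _ _).trans (add_le_add b4 b5)
  refine htot.trans ?_
  have hMM : M * M ≤ (6 / 5 * q) * (6 / 5 * q) := mul_le_mul hMq hMq hM0 (by linarith)
  have hqM : q * M ≤ q * (6 / 5 * q) := mul_le_mul_of_nonneg_left hMq hq0
  have h9 := mul_le_mul_of_nonneg_left hMM hK
  have h10 := mul_le_mul_of_nonneg_left hqM hK
  have h11 : 0 ≤ K * q ^ 2 := by positivity
  nlinarith

end

section
variable {n₁ n₂ n r : ℕ}

lemma hankel_row (hn : n + 1 = n₁ + n₂) (e : Fin n → ℂ) (i : Fin n₁) :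
    ∑ j, ‖hankel hn e i j‖ ≤ ∑ t, ‖e t‖ := by
  let g : Fin n₂ ↪ Fin n := ⟨fun j => ⟨i.1 + j.1, by have hi := i.2; have hj := j.2; omega⟩, by
    intro a b hab
    have : i.1 + a.1 = i.1 + b.1 := congrArg Fin.val hab
    ext; omega⟩
  calc ∑ j, ‖hankel hn e i j‖ = ∑ t ∈ Finset.univ.map g, ‖e t‖ := by
        rw [Finset.sum_map]; rfl
    _ ≤ ∑ t, ‖e t‖ := Finset.sum_le_univ_sum_of_nonneg fun _ => norm_nonneg _

lemma hankel_col (hn : n + 1 = n₁ + n₂) (e : Fin n → ℂ) (j : Fin n₂) :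
    ∑ i, ‖hankel hn e i j‖ ≤ ∑ t, ‖e t‖ := by
  let g : Fin n₁ ↪ Fin n := ⟨fun i => ⟨i.1 + j.1, by have hi := i.2; have hj := j.2; omega⟩, by
    intro a b hab
    have : a.1 + j.1 = b.1 + j.1 := congrArg Fin.val hab
    ext; omega⟩
  calc ∑ i, ‖hankel hn e i j‖ = ∑ t ∈ Finset.univ.map g, ‖e t‖ := by
        rw [Finset.sum_map]; rfl
    _ ≤ ∑ t, ‖e t‖ := Finset.sum_le_univ_sum_of_nonneg fun _ => norm_nonneg _

lemma exists_pair (hn : n + 1 = n₁ + n₂) (h1 : 0 < n₁) (h2 : 0 < n₂) (t : Fin n) :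
    ∃ (i : Fin n₁) (j : Fin n₂), i.1 + j.1 = t.1 := by
  have ht := t.2
  by_cases h : t.1 < n₁
  · exact ⟨⟨t.1, h⟩, ⟨0, h2⟩, by simp⟩
  · exact ⟨⟨n₁ - 1, by omega⟩, ⟨t.1 - (n₁ - 1), by omega⟩, by simp; omega⟩

lemma hankel_at (hn : n + 1 = n₁ + n₂) (x : Fin n → ℂ) (i : Fin n₁) (j : Fin n₂) (t : Fin n)
    (h : i.1 + j.1 = t.1) : hankel hn x i j = x t := by
  simp only [hankel, Matrix.of_apply]
  congr 1
  ext
  exact h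

lemma dagger_bound (hn : n + 1 = n₁ + n₂) (h1 : 0 < n₁) (h2 : 0 < n₂) (x : Fin n → ℂ)
    (L0 : Matrix (Fin n₁) (Fin n₂) ℂ) {b : ℝ}
    (hb : ∀ i j, ‖(hankel hn x - L0) i j‖ ≤ b) (t : Fin n) :
    ‖(x - hankelDagger hn L0) t‖ ≤ b := by
  obtain ⟨F, hF, hdag⟩ : ∃ F : Finset (Fin n₁ × Fin n₂), (∀ p, p ∈ F ↔ p.1.1 + p.2.1 = t.1) ∧
      hankelDagger hn L0 t = (F.card : ℂ)⁻¹ * ∑ p ∈ F, L0 p.1 p.2 :=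
    ⟨_, fun p => by simp, rfl⟩
  rw [Pi.sub_apply, hdag]
  obtain ⟨i, j, hij⟩ := exists_pair hn h1 h2 t
  have hne : 0 < F.card := Finset.card_pos.2 ⟨(i, j), (hF _).2 hij⟩
  have hneR : (0 : ℝ) < F.card := by exact_mod_cast hne
  have hneC : (F.card : ℂ) ≠ 0 := by exact_mod_cast hne.ne'
  have e1 : x t - (F.card : ℂ)⁻¹ * ∑ p ∈ F, L0 p.1 p.2
      = (F.card : ℂ)⁻¹ * ∑ p ∈ F, (hankel hn x - L0) p.1 p.2 := by
    have : ∑ p ∈ F, (hankel hn x - L0) p.1 p.2 = ∑ p ∈ F, (x t - L0 p.1 p.2) := by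
      refine Finset.sum_congr rfl fun p hp => ?_
      rw [Matrix.sub_apply, hankel_at hn x p.1 p.2 t ((hF p).1 hp)]
    rw [this, Finset.sum_sub_distrib, Finset.sum_const, nsmul_eq_mul, mul_sub,
      inv_mul_cancel_left₀ hneC]
  rw [e1, norm_mul, norm_inv, Complex.norm_natCast, inv_mul_le_iff₀ hneR]
  refine (norm_sum_le _ _).trans ?_
  refine (Finset.sum_le_sum fun p _ => hb p.1 p.2).trans ?_
  rw [Finset.sum_const, nsmul_eq_mul]

lemma vn_le_rowNorm {m : ℕ} (U : Matrix (Fin m) (Fin r) ℂ) (i : Fin m) : vn (U i) ≤ rowNorm U := by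
  rw [vn_eq]
  exact le_ciSup (f := fun i => Real.sqrt (∑ j, ‖U i j‖ ^ 2)) (Set.finite_range _).bddAbove i

lemma rowNorm_le {m : ℕ} (hm : 0 < m) (U : Matrix (Fin m) (Fin r) ℂ) {b : ℝ}
    (h : ∀ i, vn (U i) ≤ b) : rowNorm U ≤ b := by
  have : Nonempty (Fin m) := ⟨⟨0, hm⟩⟩
  refine ciSup_le fun i => ?_
  rw [← vn_eq]
  exact h i

lemma iso_rows {m : ℕ} {U : Matrix (Fin m) (Fin r) ℂ} (hU : Uᴴ * U = 1) {a : ℝ}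
    (h : ∀ i, vn (U i) ^ 2 ≤ a) : (r : ℝ) ≤ m * a := by
  have h1 : frobNorm U ^ 2 = r := by rw [frob_sq, hU]; simp
  rw [← h1, frobNorm, Real.sq_sqrt (Finset.sum_nonneg fun _ _ => Finset.sum_nonneg fun _ _ => by
    positivity)]
  calc ∑ i, ∑ j, ‖U i j‖ ^ 2 ≤ ∑ _i : Fin m, a := by
        refine Finset.sum_le_sum fun i _ => ?_
        rw [← vn_sq]; exact h i
    _ = m * a := by simp

lemma x_bound (hn : n + 1 = n₁ + n₂) (h1 : 0 < n₁) (h2 : 0 < n₂) {x : Fin n → ℂ}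
    {U : Matrix (Fin n₁) (Fin r) ℂ} {σ : Fin r → ℝ} {V : Matrix (Fin n₂) (Fin r) ℂ}
    (hS : IsSVD (hankel hn x) U σ V) {q s1 : ℝ} (hs1 : 0 ≤ s1) (hσ : ∀ i, σ i ≤ s1)
    (hU : ∀ i, vn (U i) ≤ q) (hV : ∀ i, vn (V i) ≤ q) (t : Fin n) : ‖x t‖ ≤ q ^ 2 * s1 := by
  obtain ⟨i, j, hij⟩ := exists_pair hn h1 h2 t
  have hq : 0 ≤ q := (vn_nonneg _).trans (hU i)
  rw [← hankel_at hn x i j t hij, hS.2.2.2.2]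
  refine (entry_mul _ _ i j).trans ?_
  have h3 : vn ((U * diagonal fun i => (σ i : ℂ)) i) ≤ q * s1 :=
    (row_mul _ _ i).trans (mul_le_mul (hU i) (sn_diag_le hs1 fun i => by
      rw [abs_of_pos (hS.2.2.1 i)]; exact hσ i) (sn_nonneg _) hq)
  calc _ ≤ q * s1 * q := mul_le_mul h3 (hV j) (vn_nonneg _) (mul_nonneg hq hs1)
    _ = q ^ 2 * s1 := by ring

lemma sr_le {m k : ℕ} {L : Matrix (Fin m) (Fin k) ℂ} {U : Matrix (Fin m) (Fin r) ℂ} {σ : Fin r → ℝ}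
    {V : Matrix (Fin k) (Fin r) ℂ} (hS : IsSVD L U σ V) (hr : 0 < r) {sr : ℝ} (hsr : 0 ≤ sr)
    (hσ : ∀ i, sr ≤ σ i) : sr ≤ specNorm L := by
  obtain ⟨hU, hV, -, -, hL⟩ := hS
  set b : Fin r → ℂ := Pi.single ⟨0, hr⟩ 1 with hb
  have hbn : 0 < vn b := vn_pos (by
    intro h
    have := congrFun h ⟨0, hr⟩
    simp [hb] at this)
  have h1 := sn_mulVec L (V *ᵥ b)
  have h2 : L *ᵥ (V *ᵥ b) = U *ᵥ (diagonal (fun i => (σ i : ℂ)) *ᵥ b) := by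
    rw [hL, mulVec_mulVec, mulVec_mulVec, Matrix.mul_assoc, hV, Matrix.mul_one]
  rw [h2, mulVec_iso hU, mulVec_iso hV] at h1
  have h3 := vn_diag_ge hsr hσ b
  exact le_of_mul_le_mul_right (h3.trans h1) hbn

lemma sum_le_card {s e : Fin n → ℂ} {b : ℝ} (h0 : ∀ t, s t = 0 → e t = 0) (h : ∀ t, ‖e t‖ ≤ b) :
    ∑ t, ‖e t‖ ≤ (supp s).card * b := by
  classical
  calc ∑ t, ‖e t‖ = ∑ t ∈ supp s, ‖e t‖ := by
        symm
        refine Finset.sum_subset (Finset.subset_univ _) fun t _ ht => ?_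
        have : s t = 0 := by
          by_contra hne
          exact ht (by simp [supp, hne])
        rw [h0 t this, norm_zero]
    _ ≤ ∑ _t ∈ supp s, b := Finset.sum_le_sum fun t _ => h t
    _ = (supp s).card * b := by simp

end

set_option maxHeartbeats 2000000 in
/-- Sufficient Initialization, Theorem 2 of the paper. -/
theorem statement1 :
    ∃ c : ℝ, 0 < c ∧
    ∀ (n₁ n₂ n r : ℕ) (hn : n + 1 = n₁ + n₂), 0 < n₁ → 0 < n₂ → (hr : 0 < r) →
    ∀ (μ α κ cs τ βinit : ℝ), 0 < μ → 0 < α →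
    ∀ (x s : Fin n → ℂ)
      (U : Matrix (Fin n₁) (Fin r) ℂ) (σ : Fin r → ℝ) (V : Matrix (Fin n₂) (Fin r) ℂ),
      IsSVD (hankel hn x) U σ V →
      cs = csConst n₁ n₂ n →
      rowNorm U ≤ Real.sqrt (μ * cs * r / n) →
      rowNorm V ≤ Real.sqrt (μ * cs * r / n) →
      κ = σ ⟨0, hr⟩ / σ ⟨r - 1, by omega⟩ →
      IsSparse α s →
      α ≤ c / (μ * cs * r * κ) ^ 2 →
      τ = 4 * α * μ * cs * r * κ →
      μ * cs * r * σ ⟨0, hr⟩ / (n * specNorm (hankel hn (x + s))) ≤ βinit →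
      βinit ≤ 3 * μ * cs * r * σ ⟨0, hr⟩ / (n * specNorm (hankel hn (x + s))) →
    ∀ (L0 : Matrix (Fin n₁) (Fin n₂) ℂ) (x0 : Fin n → ℂ),
      IsBestRankApprox r
        (hankel hn
          (x + s - hardThreshold (βinit * specNorm (hankel hn (x + s))) (x + s))) L0 →
      x0 = hankelDagger hn L0 →
      specNorm (hankel hn x - L0) ≤ 2 * τ * σ ⟨r - 1, by omega⟩ ∧
      vecMaxNorm (x - x0) ≤ (τ - 2 * τ ^ 2) / (8 * α * κ * n) * σ ⟨r - 1, by omega⟩ ∧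
      IsIncoherent r n (4 * μ * κ ^ 2) cs L0 := by
  refine ⟨1 / 200, by norm_num, ?_⟩
  intro n₁ n₂ n r hn h1 h2 hr μ α κ cs τ βinit hμ hα x s U σ V hS hcs hUr hVr hκ hsp hαc hτ hβ1 hβ2
    L0 x0 hB hx0
  set s1 := σ ⟨0, hr⟩ with hs1
  set sr := σ ⟨r - 1, by omega⟩ with hsr
  have hs1p : 0 < s1 := hS.2.2.1 _
  have hsrp : 0 < sr := hS.2.2.1 _
  have hσ1 : ∀ i, σ i ≤ s1 := fun i => hS.2.2.2.1 _ _ (Fin.mk_le_of_le_val (Nat.zero_le _))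
  have hσr : ∀ i, sr ≤ σ i := fun i => hS.2.2.2.1 _ _ (by
    rw [Fin.le_def]; have := i.2; simp only; omega)
  have hnN : 0 < n := by omega
  have hnp : (0 : ℝ) < n := by exact_mod_cast hnN
  have hn1p : (0 : ℝ) < n₁ := by exact_mod_cast h1
  have hrp : (0 : ℝ) < r := by exact_mod_cast hr
  have hnn1 : (n₁ : ℝ) ≤ n := by exact_mod_cast (by omega : n₁ ≤ n)
  have hcsp : 0 < cs := by
    rw [hcs]; exact lt_of_lt_of_le (div_pos hnp hn1p) (le_max_left _ _)
  set a := μ * cs * r / n with ha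
  have hap : 0 < a := by positivity
  set q := Real.sqrt a with hq
  have hqq : q ^ 2 = a := Real.sq_sqrt hap.le
  have hq0 : 0 ≤ q := Real.sqrt_nonneg _
  have hUq : ∀ i, vn (U i) ≤ q := fun i => (vn_le_rowNorm U i).trans hUr
  have hVq : ∀ i, vn (V i) ≤ q := fun i => (vn_le_rowNorm V i).trans hVr
  set B := μ * cs * r with hBdef
  have hBp : 0 < B := by positivity
  have hBa : B = n * a := by rw [ha]; field_simp
  have hB1 : 1 ≤ B := by
    have h3 : (r : ℝ) ≤ n₁ * a := iso_rows hS.1 fun i => by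
      rw [← hqq]; exact pow_le_pow_left₀ (vn_nonneg _) (hUq i) 2
    have h4 : (1 : ℝ) ≤ r := by exact_mod_cast hr
    rw [hBa]
    have := mul_le_mul_of_nonneg_right hnn1 hap.le
    linarith
  have hκ1 : 1 ≤ κ := by rw [hκ, le_div_iff₀ hsrp, one_mul]; exact hσ1 _
  have hκs : κ * sr = s1 := by rw [hκ]; field_simp
  have hτ' : τ = 4 * α * (B * κ) := by rw [hτ, hBdef]; ring
  have hBκ : 1 ≤ B * κ := one_le_mul_of_one_le_of_one_le hB1 hκ1
  have hτ0 : 0 < τ := by rw [hτ']; positivity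
  have hτ50 : τ ≤ 1 / 50 := by
    have h5 : α * (B * κ) ^ 2 ≤ 1 / 200 := by
      rwa [le_div_iff₀ (by positivity)] at hαc
    have h6 : α * (B * κ) ≤ α * (B * κ) ^ 2 := by
      apply mul_le_mul_of_nonneg_left _ hα.le
      nlinarith
    rw [hτ']; linarith
  have hxb : ∀ t, ‖x t‖ ≤ a * s1 := fun t => by
    rw [← hqq]; exact x_bound hn h1 h2 hS hs1p.le hσ1 hUq hVq t
  have hKeq : α * n * (4 * (a * s1)) = τ * sr := by
    rw [hτ', ← hκs, hBa]; ring
  have hsp' : ((supp s).card : ℝ) ≤ α * n := hsp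
  have has : 0 < a * s1 := by positivity
  -- nonvanishing of the spectral norm of the data
  have hspec : 0 < specNorm (hankel hn (x + s)) := by
    refine lt_of_le_of_ne (sn_nonneg _) fun h0 => ?_
    have hz : ∀ t, (x + s) t = 0 := by
      intro t
      obtain ⟨i, j, hij⟩ := exists_pair hn h1 h2 t
      have h7 := sn_mulVec (hankel hn (x + s)) (Pi.single j 1)
      rw [← h0, zero_mul] at h7
      have h8 := (vn_apply _ i).trans h7
      rw [mulVec_single_one] at h8
      have h9 : hankel hn (x + s) i j = 0 := by simpa using h8
      rwa [hankel_at hn _ i j t hij] at h9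
    have hsx : ∀ t, s t = 0 → x t = 0 := by
      intro t ht
      have := hz t
      simpa [ht] using this
    have hsum := sum_le_card hsx hxb
    have hsum2 : ∑ t, ‖x t‖ ≤ α * n * (a * s1) :=
      hsum.trans (mul_le_mul_of_nonneg_right hsp' has.le)
    have hle : specNorm (hankel hn x) ≤ α * n * (a * s1) :=
      schur _ (by positivity) (fun i => (hankel_row hn x i).trans hsum2)
        (fun j => (hankel_col hn x j).trans hsum2)
    have := sr_le hS hr hsrp.le hσr
    nlinarith
  set Z := specNorm (hankel hn (x + s)) with hZ
  set ζ := βinit * Z with hζ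
  have hζ1 : a * s1 ≤ ζ := by
    have : B * s1 / (n * Z) * Z ≤ βinit * Z := mul_le_mul_of_nonneg_right hβ1 hspec.le
    have e : B * s1 / (n * Z) * Z = a * s1 := by rw [ha]; field_simp
    linarith
  have hζ2 : ζ ≤ 3 * (a * s1) := by
    have : βinit * Z ≤ 3 * μ * cs * r * s1 / (n * Z) * Z := mul_le_mul_of_nonneg_right hβ2 hspec.le
    have e : 3 * μ * cs * r * s1 / (n * Z) * Z = 3 * (a * s1) := by rw [ha, hBdef]; field_simp
    linarith
  set e : Fin n → ℂ := s - hardThreshold ζ (x + s) with he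
  have he0 : ∀ t, s t = 0 → e t = 0 := by
    intro t ht
    have h8 : ¬ ζ < ‖x t‖ := not_lt.2 ((hxb t).trans hζ1)
    simp [he, hardThreshold, ht, h8]
  have heb : ∀ t, ‖e t‖ ≤ 4 * (a * s1) := by
    intro t
    have hxt := hxb t
    by_cases h8 : ζ < ‖x t + s t‖
    · have : e t = - x t := by simp [he, hardThreshold, h8]
      rw [this, norm_neg]; linarith
    · have h9 : e t = s t := by simp [he, hardThreshold, h8]
      rw [h9]
      have h10 : s t = (x t + s t) - x t := by ring
      rw [h10]
      refine (norm_sub_le _ _).trans ?_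
      linarith [not_lt.1 h8]
  have hsumK : ∑ t, ‖e t‖ ≤ τ * sr := by
    rw [← hKeq]
    exact (sum_le_card he0 heb).trans (mul_le_mul_of_nonneg_right hsp' (by positivity))
  have hsplit : hankel hn (x + s - hardThreshold ζ (x + s)) = hankel hn x + hankel hn e := by
    ext i j
    simp only [hankel, Matrix.of_apply, Matrix.add_apply, he, Pi.add_apply, Pi.sub_apply]
    ring
  rw [hsplit] at hB
  obtain ⟨c1, c2, X, S, Y, hS0, hX, hY⟩ := core h1 h2 hS hsrp hσr (mul_nonneg hτ0.le hsrp.le)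
    (by nlinarith) (fun i => (hankel_row hn e i).trans hsumK)
    (fun j => (hankel_col hn e j).trans hsumK) hUq hVq hB
  have hκp : 0 < κ := by linarith
  refine ⟨by linarith, ?_, X, S, Y, hS0, ?_, ?_⟩
  · have : Nonempty (Fin n) := ⟨⟨0, hnN⟩⟩
    refine ciSup_le fun t => ?_
    rw [hx0]
    refine (dagger_bound hn h1 h2 x L0 c2 t).trans ?_
    have e1 : (τ - 2 * τ ^ 2) / (8 * α * κ * n) = (1 - 2 * τ) / 2 * a := by
      rw [div_eq_iff (by positivity)]
      have : τ = 4 * α * (n * a * κ) := by rw [hτ', hBa]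
      linear_combination (1 - 2 * τ) * this
    rw [e1, hqq]
    have h8 : 0 ≤ a * sr := by positivity
    nlinarith
  all_goals
    refine rowNorm_le (by assumption) _ fun i => ?_
    first | refine (hX i).trans ?_ | refine (hY i).trans ?_
    refine Real.le_sqrt_of_sq_le ?_
    have e2 : 4 * μ * κ ^ 2 * cs * r / n = 4 * κ ^ 2 * a := by rw [ha, hBdef]; ring
    rw [mul_pow, hqq, e2]
    have : 1 ≤ κ ^ 2 := one_le_pow₀ hκ1
    nlinarith

end ASAP
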